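/- (Higher-order div-curl estimate) Let λ : ℝ³ → ℝ be a smooth function with λ ≥ 1 and |∇λ| ≤ C₀ λ on ℝ³. Let z be a smooth divergence-free vector field on ℝ³ all of whose weighted derivatives √λ ∂^β z lie in L²(ℝ³). Then for every multi-index γ, ‖√λ ∇(∂^γ z)‖²_{L²(ℝ³)} ≤ C ( ‖√λ z‖²_{L²(ℝ³)} + Σ_{|β| ≤ |γ|} ‖√λ curl(∂^β z)‖²_{L²(ℝ³)} ), where the sum is over all multi-indices β of order at most |γ| and C depends only on C₀ and |γ|. -/

import Mathlib

open MeasureTheory Real Set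
open scoped ENNReal NNReal BigOperators Topology

noncomputable section

/-- Spatial slice `ℝ³`. -/
abbrev Sp : Type := EuclideanSpace ℝ (Fin 3)

/-- Build a point of `ℝ³` from its three coordinates. -/
def pt3 (a b c : ℝ) : Sp := (WithLp.equiv 2 (Fin 3 → ℝ)).symm ![a, b, c]

variable {F : Type*} [NormedAddCommGroup F] [NormedSpace ℝ F]

/-- Spatial partial derivative `∂ᵢ` for functions on `ℝ³`. -/
def pd (i : Fin 3) (f : Sp → F) : Sp → F :=
  fun x => fderiv ℝ f x (EuclideanSpace.single i 1)

/-- Multi-index partial derivative `∂^β`. -/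
def mpd (β : Fin 3 → ℕ) (f : Sp → F) : Sp → F :=
  (pd 0)^[β 0] ((pd 1)^[β 1] ((pd 2)^[β 2] f))

/-- The totally antisymmetric Levi-Civita symbol on `Fin 3`. -/
def lev (i j k : Fin 3) : ℝ :=
  if (i, j, k) = (0, 1, 2) ∨ (i, j, k) = (1, 2, 0) ∨ (i, j, k) = (2, 0, 1) then 1
  else if (i, j, k) = (0, 2, 1) ∨ (i, j, k) = (2, 1, 0) ∨ (i, j, k) = (1, 0, 2) then -1
  else 0

/-- curl of a vector field on `ℝ³`:  `(curl f)ₖ = ε_{ijk} ∂_i f^j`. -/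
def curl3 (v : Sp → Sp) : Sp → Sp :=
  fun x => (WithLp.equiv 2 (Fin 3 → ℝ)).symm
    (fun k => ∑ i, ∑ j, lev i j k * pd i (fun y => v y j) x)

/-- divergence of a vector field on `ℝ³`. -/
def div3 (v : Sp → Sp) : Sp → ℝ := fun x => ∑ i, pd i (fun y => v y i) x

/-- time derivative `∂_t` for functions on spacetime `ℝ × ℝ³`. -/
def pt (f : ℝ × Sp → F) : ℝ × Sp → F := fun q => deriv (fun s => f (s, q.2)) q.1

/-- spatial derivative `∂_{xᵢ}` for functions on spacetime. -/
def pX (i : Fin 3) (f : ℝ × Sp → F) : ℝ × Sp → F := fun q => pd i (fun y => f (q.1, y)) q.2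

/-- spatial gradient `∇p` of a scalar function on spacetime. -/
def grad3 (p : ℝ × Sp → ℝ) : ℝ × Sp → Sp :=
  fun q => (WithLp.equiv 2 (Fin 3 → ℝ)).symm (fun i => pX i p q)

/-- convection term `(z · ∇) w`. -/
def conv (z w : ℝ × Sp → Sp) : ℝ × Sp → Sp :=
  fun q => (WithLp.equiv 2 (Fin 3 → ℝ)).symm
    (fun k => ∑ i, z q i * pX i (fun r => w r k) q)

/-- The ideal incompressible MHD system in Elsässer variables on `ℝ_t × ℝ³_x`, with a
background magnetic field `B₀ = e₃`:
`∂_t z₊ − ∂_{x₃} z₊ = −∇p − (z₋·∇)z₊`, `∂_t z₋ + ∂_{x₃} z₋ = −∇p − (z₊·∇)z₋`,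
`div z₊ = div z₋ = 0`, the pressure being given by the Newtonian potential solving
`−Δp = ∂_i z₋^j ∂_j z₊^i`. -/
structure IsMHDSolution (zp zm : ℝ × Sp → Sp) (p : ℝ × Sp → ℝ) : Prop where
  smooth_zp : ContDiff ℝ (⊤ : ℕ∞) zp
  smooth_zm : ContDiff ℝ (⊤ : ℕ∞) zm
  smooth_p : ContDiff ℝ (⊤ : ℕ∞) p
  eq_zp : ∀ q : ℝ × Sp, pt zp q - pX 2 zp q = -(grad3 p q) - conv zm zp q
  eq_zm : ∀ q : ℝ × Sp, pt zm q + pX 2 zm q = -(grad3 p q) - conv zp zm q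
  div_zp : ∀ q : ℝ × Sp, div3 (fun y => zp (q.1, y)) q.2 = 0
  div_zm : ∀ q : ℝ × Sp, div3 (fun y => zm (q.1, y)) q.2 = 0
  newtonian : ∀ (t : ℝ) (x : Sp), p (t, x) =
    (1 / (4 * π)) * ∫ y : Sp, ‖x - y‖⁻¹ *
      ∑ i, ∑ j, pd i (fun u => zm (t, u) j) y * pd j (fun u => zp (t, u) i) y

/-- Weighted L² energy of the `k`-th derivatives on a time slice, with squared weight
`(1+|x₃ − b|²)^(1+δ)`. -/
def wSliceE (δ b : ℝ) (k : ℕ) (g : Sp → Sp) : ℝ≥0∞ :=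
  ∫⁻ x : Sp, ENNReal.ofReal ((1 + |x 2 - b| ^ 2) ^ (1 + δ) * ‖iteratedFDeriv ℝ k g x‖ ^ 2)

/-- `E^{(k)}_+(t)`-type energy for `z₊`, with weight `⟨u₋⟩^{2ω} = (1+|x₃+(t+a)|²)^{1+δ}`. -/
def energyP (δ a : ℝ) (k : ℕ) (f : ℝ × Sp → Sp) (t : ℝ) : ℝ≥0∞ :=
  wSliceE δ (-(t + a)) k (fun y => f (t, y))

/-- `E^{(k)}_-(t)`-type energy for `z₋`, with weight `⟨u₊⟩^{2ω} = (1+|x₃−(t+a)|²)^{1+δ}`. -/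
def energyM (δ a : ℝ) (k : ℕ) (f : ℝ × Sp → Sp) (t : ℝ) : ℝ≥0∞ :=
  wSliceE δ (t + a) k (fun y => f (t, y))

/-- Total initial weighted energy `𝓔^{N*}_+(0)` of `z₊`. -/
def EInitP (δ a : ℝ) (N : ℕ) (f : ℝ × Sp → Sp) : ℝ≥0∞ :=
  ∑ k ∈ Finset.range (N + 2), energyP δ a k f 0

/-- Total initial weighted energy `𝓔^{N*}_-(0)` of `z₋`. -/
def EInitM (δ a : ℝ) (N : ℕ) (f : ℝ × Sp → Sp) : ℝ≥0∞ :=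
  ∑ k ∈ Finset.range (N + 2), energyM δ a k f 0

/-- Total initial weighted energy `𝓔^{N*}(0)` expressed on initial data. -/
def EInit0 (δ a : ℝ) (N : ℕ) (zp0 zm0 : Sp → Sp) : ℝ≥0∞ :=
  ∑ k ∈ Finset.range (N + 2), (wSliceE δ (-a) k zp0 + wSliceE δ a k zm0)

/-- Flux of `g` through the characteristic hypersurface `C^{+,t}_{u₊} = {x₃ = u₊ + τ}`,
with weight `⟨u₋⟩^{2ω}` and surface measure `dσ₊ = √2 dx₁dx₂dτ`. -/
def fluxP (δ a : ℝ) (g : ℝ × Sp → Sp) (t u : ℝ) : ℝ≥0∞ :=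
  ∫⁻ τ in Icc (0 : ℝ) t, ∫⁻ y : ℝ × ℝ,
    ENNReal.ofReal (Real.sqrt 2 * (1 + |(u + τ) + (τ + a)| ^ 2) ^ (1 + δ) *
      ‖g (τ, pt3 y.1 y.2 (u + τ))‖ ^ 2)

/-- Flux of `g` through the characteristic hypersurface `C^{−,t}_{u₋} = {x₃ = u₋ − τ}`,
with weight `⟨u₊⟩^{2ω}` and surface measure `dσ₋ = √2 dx₁dx₂dτ`. -/
def fluxM (δ a : ℝ) (g : ℝ × Sp → Sp) (t u : ℝ) : ℝ≥0∞ :=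
  ∫⁻ τ in Icc (0 : ℝ) t, ∫⁻ y : ℝ × ℝ,
    ENNReal.ofReal (Real.sqrt 2 * (1 + |(u - τ) - (τ + a)| ^ 2) ^ (1 + δ) *
      ‖g (τ, pt3 y.1 y.2 (u - τ))‖ ^ 2)

/-- `j^{(α)} = curl ∂^α z` (spatial curl on each time slice). -/
def jA (α : Fin 3 → ℕ) (f : ℝ × Sp → Sp) : ℝ × Sp → Sp :=
  fun q => curl3 (mpd α (fun y => f (q.1, y))) q.2

/-- The nonlinearity `∇p + (z₋·∇)z₊` in the equation for `z₊`. -/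
def NLp (zp zm : ℝ × Sp → Sp) (p : ℝ × Sp → ℝ) : ℝ × Sp → Sp :=
  fun q => grad3 p q + conv zm zp q

/-- The nonlinearity `∇p + (z₊·∇)z₋` in the equation for `z₋`. -/
def NLm (zp zm : ℝ × Sp → Sp) (p : ℝ × Sp → ℝ) : ℝ × Sp → Sp :=
  fun q => grad3 p q + conv zp zm q

/-- Future scattering field of `z₊` on `𝓕₊`, in the coordinates `(x₁,x₂,u₋)`. -/
def scatPfut (zp zm : ℝ × Sp → Sp) (p : ℝ × Sp → ℝ) (x1 x2 u : ℝ) : Sp :=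
  zp (0, pt3 x1 x2 u) - ∫ τ in Ioi (0 : ℝ), NLp zp zm p (τ, pt3 x1 x2 (u - τ))

/-- Future scattering field of `z₋` on `𝓕₋`, in the coordinates `(x₁,x₂,u₊)`. -/
def scatMfut (zp zm : ℝ × Sp → Sp) (p : ℝ × Sp → ℝ) (x1 x2 u : ℝ) : Sp :=
  zm (0, pt3 x1 x2 u) - ∫ τ in Ioi (0 : ℝ), NLm zp zm p (τ, pt3 x1 x2 (u + τ))

/-- Past scattering field of `z₊` on `𝓟₊` (note `∫₀^{−∞} = −∫_{Iio 0}`). -/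
def scatPpast (zp zm : ℝ × Sp → Sp) (p : ℝ × Sp → ℝ) (x1 x2 u : ℝ) : Sp :=
  zp (0, pt3 x1 x2 u) + ∫ τ in Iio (0 : ℝ), NLp zp zm p (τ, pt3 x1 x2 (u - τ))

/-- Past scattering field of `z₋` on `𝓟₋`. -/
def scatMpast (zp zm : ℝ × Sp → Sp) (p : ℝ × Sp → ℝ) (x1 x2 u : ℝ) : Sp :=
  zm (0, pt3 x1 x2 u) + ∫ τ in Iio (0 : ℝ), NLm zp zm p (τ, pt3 x1 x2 (u + τ))

/-- The weight `⟨·⟩ = (1+|x₃−b|²)^{1/2}`. -/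
def wgt (b : ℝ) (x : Sp) : ℝ := Real.sqrt (1 + |x 2 - b| ^ 2)

lemma contDiff_pd {f : Sp → F} (hf : ContDiff ℝ (⊤ : ℕ∞) f) (i : Fin 3) :
    ContDiff ℝ (⊤ : ℕ∞) (pd i f) :=
  (hf.fderiv_right (m := (⊤ : ℕ∞)) (by simp)).clm_apply contDiff_const

lemma contDiff_pd_iterate {f : Sp → F} (hf : ContDiff ℝ (⊤ : ℕ∞) f) (i : Fin 3) (n : ℕ) :
    ContDiff ℝ (⊤ : ℕ∞) ((pd i)^[n] f) := by
  induction n with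
  | zero => exact hf
  | succ n ih => rw [Function.iterate_succ_apply']; exact contDiff_pd ih i

lemma contDiff_mpd {f : Sp → F} (hf : ContDiff ℝ (⊤ : ℕ∞) f) (β : Fin 3 → ℕ) :
    ContDiff ℝ (⊤ : ℕ∞) (mpd β f) :=
  contDiff_pd_iterate (contDiff_pd_iterate (contDiff_pd_iterate hf _ _) _ _) _ _

/-- Partial derivatives of a smooth function commute. -/
lemma pd_comm {f : Sp → F} (hf : ContDiff ℝ (⊤ : ℕ∞) f) (i j : Fin 3) :
    pd i (pd j f) = pd j (pd i f) := by
  have hd : Differentiable ℝ (fderiv ℝ f) :=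
    (hf.fderiv_right (m := (⊤ : ℕ∞)) (by simp)).differentiable (by simp)
  have key (i j : Fin 3) (x : Sp) : pd i (pd j f) x
      = fderiv ℝ (fderiv ℝ f) x (EuclideanSpace.single i 1) (EuclideanSpace.single j 1) := by
    unfold pd
    rw [fderiv_clm_apply (hd x) (by fun_prop)]
    simp
  funext x
  rw [key, key]
  refine hf.contDiffAt.isSymmSndFDerivAt ?_ _ _
  rw [minSmoothness_of_isRCLikeNormedField]
  exact WithTop.coe_le_coe.2 le_top

lemma pd_pd_iterate_comm {f : Sp → F} (hf : ContDiff ℝ (⊤ : ℕ∞) f) (i j : Fin 3) (n : ℕ) :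
    pd i ((pd j)^[n] f) = (pd j)^[n] (pd i f) := by
  induction n with
  | zero => rfl
  | succ n ih =>
    rw [Function.iterate_succ_apply', pd_comm (contDiff_pd_iterate hf j n), ih,
      Function.iterate_succ_apply']

lemma pd_mpd {f : Sp → F} (hf : ContDiff ℝ (⊤ : ℕ∞) f) (i : Fin 3) (β : Fin 3 → ℕ) :
    pd i (mpd β f) = mpd (Function.update β i (β i + 1)) f := by
  have h2 := contDiff_pd_iterate hf 2 (β 2)
  have h1 := contDiff_pd_iterate h2 1 (β 1)
  fin_cases i
  · simp [mpd, Function.iterate_succ_apply', -Function.iterate_succ]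
  · simp [mpd, Function.iterate_succ_apply', pd_pd_iterate_comm h1, -Function.iterate_succ]
  · simp [mpd, Function.iterate_succ_apply', pd_pd_iterate_comm h1, pd_pd_iterate_comm h2,
      -Function.iterate_succ]

/-- Taking a component commutes with taking a partial derivative. -/
lemma pd_component {v : Sp → Sp} (hv : ContDiff ℝ (⊤ : ℕ∞) v) (i j : Fin 3) :
    pd i (fun y => v y j) = fun y => pd i v y j := by
  funext x
  have h := ((EuclideanSpace.proj j : Sp →L[ℝ] ℝ).hasFDerivAt.comp x
    (hv.differentiable (by simp) x).hasFDerivAt).fderiv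
  exact congrArg (fun L => L (EuclideanSpace.single i 1)) h

lemma contDiff_component {v : Sp → Sp} (hv : ContDiff ℝ (⊤ : ℕ∞) v) (j : Fin 3) :
    ContDiff ℝ (⊤ : ℕ∞) (fun y => v y j) :=
  (EuclideanSpace.proj j : Sp →L[ℝ] ℝ).contDiff.comp hv

lemma pd_mul {f g : Sp → ℝ} (hf : ContDiff ℝ (⊤ : ℕ∞) f) (hg : ContDiff ℝ (⊤ : ℕ∞) g)
    (i : Fin 3) (x : Sp) :
    pd i (fun y => f y * g y) x = f x * pd i g x + pd i f x * g x := by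
  unfold pd
  rw [fderiv_fun_mul (hf.differentiable (by simp) x) (hg.differentiable (by simp) x)]
  simp [mul_comm]

lemma div3_pd {v : Sp → Sp} (hv : ContDiff ℝ (⊤ : ℕ∞) v) (k : Fin 3) :
    div3 (pd k v) = pd k (div3 v) := by
  funext x
  have hd (i : Fin 3) : DifferentiableAt ℝ (pd i (fun y => v y i)) x :=
    (contDiff_pd (contDiff_component hv i) i).differentiable (by simp) x
  have hs : pd k (div3 v) x = ∑ i, pd k (pd i (fun y => v y i)) x := by
    change fderiv ℝ (fun y => ∑ i, pd i (fun y => v y i) y) x _ = _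
    rw [fderiv_fun_sum fun i _ => hd i]
    simp [pd]
  rw [hs]
  refine Finset.sum_congr rfl fun i _ => ?_
  rw [← pd_component hv, pd_comm (contDiff_component hv i)]

lemma div3_mpd_eq_zero {z : Sp → Sp} (hz : ContDiff ℝ (⊤ : ℕ∞) z) (hdiv : div3 z = 0)
    (β : Fin 3 → ℕ) : div3 (mpd β z) = 0 := by
  have iter (i : Fin 3) (n : ℕ) (v : Sp → Sp) (hv : ContDiff ℝ (⊤ : ℕ∞) v) (h : div3 v = 0) :
      div3 ((pd i)^[n] v) = 0 := by
    induction n with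
    | zero => exact h
    | succ n ih =>
      rw [Function.iterate_succ_apply', div3_pd (contDiff_pd_iterate hv i n), ih]
      funext x
      simp [pd]
  have h2 := contDiff_pd_iterate hz 2 (β 2)
  have h1 := contDiff_pd_iterate h2 1 (β 1)
  exact iter _ _ _ h1 (iter _ _ _ h2 (iter _ _ _ hz hdiv))

/-- The operator norm is bounded by the Hilbert–Schmidt norm. -/
lemma norm_fderiv_sq_le_sum_pd (f : Sp → F) (x : Sp) :
    ‖fderiv ℝ f x‖ ^ 2 ≤ ∑ i, ‖pd i f x‖ ^ 2 := by
  have h0 : 0 ≤ ∑ i, ‖pd i f x‖ ^ 2 := by positivity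
  suffices h : ‖fderiv ℝ f x‖ ≤ √(∑ i, ‖pd i f x‖ ^ 2) by
    calc ‖fderiv ℝ f x‖ ^ 2 ≤ √(∑ i, ‖pd i f x‖ ^ 2) ^ 2 := by gcongr
      _ = _ := Real.sq_sqrt h0
  refine ContinuousLinearMap.opNorm_le_bound _ (Real.sqrt_nonneg _) fun v => ?_
  have hv : v = ∑ i, v i • EuclideanSpace.single i (1 : ℝ) := by
    ext j
    simp [Finset.sum_apply, Pi.single_apply]
  calc ‖fderiv ℝ f x v‖ = ‖∑ i, v i • pd i f x‖ := by
        conv_lhs => rw [hv, map_sum]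
        simp [pd]
    _ ≤ ∑ i, ‖pd i f x‖ * ‖v i‖ := by
        refine (norm_sum_le _ _).trans (Finset.sum_le_sum fun i _ => ?_)
        rw [norm_smul, mul_comm]
    _ ≤ √(∑ i, ‖pd i f x‖ ^ 2) * √(∑ i, ‖v i‖ ^ 2) := Real.sum_mul_le_sqrt_mul_sqrt _ _ _
    _ = √(∑ i, ‖pd i f x‖ ^ 2) * ‖v‖ := by rw [EuclideanSpace.norm_eq]

lemma norm_curl3_sq (v : Sp → Sp) (x : Sp) :
    ‖curl3 v x‖ ^ 2 = ∑ i, ∑ j, (pd i (fun y => v y j) x) ^ 2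
      - ∑ i, ∑ j, pd i (fun y => v y j) x * pd j (fun y => v y i) x := by
  rw [EuclideanSpace.real_norm_sq_eq]
  simp only [curl3, Fin.sum_univ_three]
  simp [lev]
  ring

/-- A weighted product of two functions is integrable when their weighted squares are. -/
lemma integrable_weight_mul {lam f g : Sp → ℝ} (hlam : Continuous lam) (hpos : ∀ x, 0 ≤ lam x)
    (hf : Continuous f) (hg : Continuous g) (hf2 : Integrable fun x => lam x * f x ^ 2)
    (hg2 : Integrable fun x => lam x * g x ^ 2) :
    Integrable fun x => lam x * (f x * g x) := by
  refine (hf2.add hg2).mono' (by fun_prop) (Filter.Eventually.of_forall fun x => ?_)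
  have h : |f x * g x| ≤ f x ^ 2 + g x ^ 2 := by
    rw [abs_le]; constructor <;> nlinarith [sq_nonneg (f x + g x), sq_nonneg (f x - g x)]
  rw [Real.norm_eq_abs, abs_mul, abs_of_nonneg (hpos x)]
  simpa [mul_add] using mul_le_mul_of_nonneg_left h (hpos x)

lemma integrable_weight_component {lam : Sp → ℝ} {v : Sp → Sp} (hlam : Continuous lam)
    (hpos : ∀ x, 0 ≤ lam x) (hv : Continuous v) (h : Integrable fun x => lam x * ‖v x‖ ^ 2)
    (j : Fin 3) : Integrable fun x => lam x * v x j ^ 2 := by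
  refine h.mono' (by fun_prop) (Filter.Eventually.of_forall fun x => ?_)
  rw [Real.norm_eq_abs, abs_of_nonneg (mul_nonneg (hpos x) (sq_nonneg _))]
  refine mul_le_mul_of_nonneg_left ?_ (hpos x)
  rw [EuclideanSpace.real_norm_sq_eq]
  exact Finset.single_le_sum (f := fun i => v x i ^ 2) (fun i _ => sq_nonneg _)
    (Finset.mem_univ j)

lemma abs_pd_le_norm_fderiv (f : Sp → ℝ) (i : Fin 3) (x : Sp) : |pd i f x| ≤ ‖fderiv ℝ f x‖ := by
  have := (fderiv ℝ f x).le_opNorm (EuclideanSpace.single i 1)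
  simpa [pd] using this

/-- Weighted integration by parts for the quadratic form `∂ᵢwⱼ ∂ⱼwᵢ` of a divergence-free field,
with the resulting term absorbed by Young's inequality. -/
lemma integral_weight_sum_pd_mul_pd_le {C₀ : ℝ} {lam : Sp → ℝ}
    (hlam : ContDiff ℝ (⊤ : ℕ∞) lam) (hone : ∀ x, 1 ≤ lam x)
    (hgrad : ∀ x, ‖fderiv ℝ lam x‖ ≤ C₀ * lam x)
    {a : Fin 3 → Sp → ℝ} (ha : ∀ j, ContDiff ℝ (⊤ : ℕ∞) (a j)) (hdiv : ∀ x, ∑ i, pd i (a i) x = 0)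
    (h0 : ∀ j, Integrable fun x => lam x * a j x ^ 2)
    (h1 : ∀ i j, Integrable fun x => lam x * pd i (a j) x ^ 2)
    (h2 : ∀ i j k, Integrable fun x => lam x * pd i (pd j (a k)) x ^ 2) :
    ∫ x, lam x * ∑ i, ∑ j, pd i (a j) x * pd j (a i) x
      ≤ 3 * C₀ ^ 2 / 2 * (∫ x, lam x * ∑ j, a j x ^ 2)
        + 1 / 2 * ∫ x, lam x * ∑ i, ∑ j, pd i (a j) x ^ 2 := by
  have hpos (x : Sp) : 0 ≤ lam x := zero_le_one.trans (hone x)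
  have ca (j : Fin 3) : Continuous (a j) := (ha j).continuous
  have cpa (i j : Fin 3) : Continuous (pd i (a j)) := (contDiff_pd (ha j) i).continuous
  have cppa (i j k : Fin 3) : Continuous (pd i (pd j (a k))) :=
    (contDiff_pd (contDiff_pd (ha k) j) i).continuous
  have cl := hlam.continuous
  have cpl (i : Fin 3) : Continuous (pd i lam) := (contDiff_pd hlam i).continuous
  have I1 (i j : Fin 3) := integrable_weight_mul cl hpos (cpa i j) (cpa j i) (h1 i j) (h1 j i)
  have I2 (i j : Fin 3) := integrable_weight_mul cl hpos (ca j) (cppa i j i) (h0 j) (h2 i j i)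
  have I0 (i j : Fin 3) := integrable_weight_mul cl hpos (ca j) (cpa j i) (h0 j) (h1 j i)
  have I3 (i j : Fin 3) : Integrable fun x => pd i lam x * (a j x * pd j (a i) x) := by
    have hn : Integrable fun x => C₀ * |lam x * (a j x * pd j (a i) x)| := (I0 i j).abs.const_mul C₀
    refine hn.mono' ?_ (Filter.Eventually.of_forall fun x => ?_)
    · exact ((cpl i).mul ((ca j).mul (cpa j i))).aestronglyMeasurable
    · rw [Real.norm_eq_abs, abs_mul, abs_mul (lam x), abs_of_nonneg (hpos x), ← mul_assoc]
      exact mul_le_mul_of_nonneg_right ((abs_pd_le_norm_fderiv lam i x).trans (hgrad x))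
        (abs_nonneg _)
  have parts (i j : Fin 3) : ∫ x, lam x * (pd i (a j) x * pd j (a i) x)
      = -(∫ x, pd i lam x * (a j x * pd j (a i) x))
        - ∫ x, lam x * (a j x * pd i (pd j (a i)) x) := by
    have hprod (x : Sp) : lam x * pd i (fun y => a j y * pd j (a i) y) x
        = lam x * (a j x * pd i (pd j (a i)) x) + lam x * (pd i (a j) x * pd j (a i) x) := by
      rw [pd_mul (ha j) (contDiff_pd (ha i) j)]; ring
    have key : ∫ x, lam x * pd i (fun y => a j y * pd j (a i) y) x
        = -∫ x, pd i lam x * (a j x * pd j (a i) x) := by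
      refine integral_mul_fderiv_eq_neg_fderiv_mul_of_integrable
        (v := EuclideanSpace.single i 1) (I3 i j) ?_ (I0 i j)
        (fun x _ => hlam.differentiable (by simp) x)
        (fun x _ => ((ha j).mul (contDiff_pd (ha i) j)).differentiable (by simp) x)
      exact ((I2 i j).add (I1 i j)).congr (Filter.Eventually.of_forall fun x => (hprod x).symm)
    simp only [hprod] at key
    rw [integral_add (I2 i j) (I1 i j)] at key
    linarith
  have hsecond : ∑ i, ∑ j, ∫ x, lam x * (a j x * pd i (pd j (a i)) x) = 0 := by
    rw [Finset.sum_comm]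
    refine Finset.sum_eq_zero fun j _ => ?_
    rw [← integral_finsetSum _ fun i _ => I2 i j]
    refine integral_eq_zero_of_ae (Filter.Eventually.of_forall fun x => ?_)
    have hd : ∑ i, pd i (pd j (a i)) x = 0 := by
      have hz : (fun y => ∑ i, pd i (a i) y) = fun _ => (0 : ℝ) := funext hdiv
      have hs := congrArg (fun f => pd j f x) hz
      have hdiff (i : Fin 3) : DifferentiableAt ℝ (pd i (a i)) x :=
        (contDiff_pd (ha i) i).differentiable (by simp) x
      have hL : pd j (fun y => ∑ i, pd i (a i) y) x = ∑ i, pd j (pd i (a i)) x := by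
        change fderiv ℝ (fun y => ∑ i, pd i (a i) y) x _ = _
        rw [fderiv_fun_sum fun i _ => hdiff i]
        simp [pd]
      have hR : pd j (fun _ : Sp => (0 : ℝ)) x = 0 := by simp [pd]
      simp only [hL, hR] at hs
      rw [← hs]
      exact Finset.sum_congr rfl fun i _ => by rw [pd_comm (ha i)]
    simp only [← Finset.mul_sum, hd, mul_zero, Pi.zero_apply]
  have hfirst (i j : Fin 3) : -(∫ x, pd i lam x * (a j x * pd j (a i) x))
      ≤ C₀ ^ 2 / 2 * (∫ x, lam x * a j x ^ 2) + 1 / 2 * ∫ x, lam x * pd j (a i) x ^ 2 := by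
    rw [← integral_neg, ← integral_const_mul, ← integral_const_mul,
      ← integral_add ((h0 j).const_mul _) ((h1 j i).const_mul _)]
    refine integral_mono (I3 i j).neg (((h0 j).const_mul _).add ((h1 j i).const_mul _)) fun x => ?_
    have hb := (abs_pd_le_norm_fderiv lam i x).trans (hgrad x)
    have h3 : -(pd i lam x * (a j x * pd j (a i) x))
        ≤ C₀ * lam x * (|a j x| * |pd j (a i) x|) := by
      refine (neg_le_abs _).trans ?_
      rw [abs_mul, abs_mul]
      exact mul_le_mul_of_nonneg_right hb (by positivity)
    have h4 : C₀ * (|a j x| * |pd j (a i) x|)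
        ≤ C₀ ^ 2 / 2 * a j x ^ 2 + 1 / 2 * pd j (a i) x ^ 2 := by
      rw [← sq_abs (a j x), ← sq_abs (pd j (a i) x)]
      nlinarith [sq_nonneg (C₀ * |a j x| - |pd j (a i) x|)]
    have h5 := mul_le_mul_of_nonneg_left h4 (hpos x)
    simp only
    linarith
  have e1 : ∫ x, lam x * ∑ i, ∑ j, pd i (a j) x * pd j (a i) x
      = ∑ i, ∑ j, ∫ x, lam x * (pd i (a j) x * pd j (a i) x) := by
    simp only [Finset.mul_sum]
    rw [integral_finsetSum _ fun i _ => integrable_finsetSum _ fun j _ => I1 i j]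
    exact Finset.sum_congr rfl fun i _ => integral_finsetSum _ fun j _ => I1 i j
  have e2 : ∫ x, lam x * ∑ j, a j x ^ 2 = ∑ j, ∫ x, lam x * a j x ^ 2 := by
    simp only [Finset.mul_sum]
    exact integral_finsetSum _ fun j _ => h0 j
  have e3 : ∫ x, lam x * ∑ i, ∑ j, pd i (a j) x ^ 2
      = ∑ i, ∑ j, ∫ x, lam x * pd i (a j) x ^ 2 := by
    simp only [Finset.mul_sum]
    rw [integral_finsetSum _ fun i _ => integrable_finsetSum _ fun j _ => h1 i j]
    exact Finset.sum_congr rfl fun i _ => integral_finsetSum _ fun j _ => h1 i j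
  rw [e1, e2, e3]
  calc ∑ i, ∑ j, ∫ x, lam x * (pd i (a j) x * pd j (a i) x)
      = ∑ i, ∑ j, -(∫ x, pd i lam x * (a j x * pd j (a i) x)) := by
        simp only [parts, Finset.sum_sub_distrib, hsecond, sub_zero]
    _ ≤ ∑ i, ∑ j, (C₀ ^ 2 / 2 * (∫ x, lam x * a j x ^ 2)
          + 1 / 2 * ∫ x, lam x * pd j (a i) x ^ 2) :=
        Finset.sum_le_sum fun i _ => Finset.sum_le_sum fun j _ => hfirst i j
    _ = _ := by
        simp only [Fin.sum_univ_three]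
        ring

/-- The weighted first-order div-curl estimate for a divergence-free field. -/
lemma weighted_div_curl {C₀ : ℝ} {lam : Sp → ℝ}
    (hlam : ContDiff ℝ (⊤ : ℕ∞) lam) (hone : ∀ x, 1 ≤ lam x)
    (hgrad : ∀ x, ‖fderiv ℝ lam x‖ ≤ C₀ * lam x)
    {w : Sp → Sp} (hw : ContDiff ℝ (⊤ : ℕ∞) w) (hdiv : div3 w = 0)
    (h0 : Integrable fun x => lam x * ‖w x‖ ^ 2)
    (h1 : ∀ i, Integrable fun x => lam x * ‖pd i w x‖ ^ 2)
    (h2 : ∀ i j, Integrable fun x => lam x * ‖pd i (pd j w) x‖ ^ 2) :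
    ∫ x, lam x * ∑ i, ‖pd i w x‖ ^ 2
      ≤ 2 * (∫ x, lam x * ‖curl3 w x‖ ^ 2) + 3 * C₀ ^ 2 * ∫ x, lam x * ‖w x‖ ^ 2 := by
  have hpos (x : Sp) : 0 ≤ lam x := zero_le_one.trans (hone x)
  have cl := hlam.continuous
  have ha (j : Fin 3) := contDiff_component hw j
  have cp (i j : Fin 3) : Continuous (pd i (fun y => w y j)) := (contDiff_pd (ha j) i).continuous
  have k0 (j : Fin 3) := integrable_weight_component cl hpos hw.continuous h0 j
  have k1 (i j : Fin 3) : Integrable fun x => lam x * pd i (fun y => w y j) x ^ 2 := by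
    rw [pd_component hw]
    exact integrable_weight_component cl hpos (contDiff_pd hw i).continuous (h1 i) j
  have k2 (i j k : Fin 3) :
      Integrable fun x => lam x * pd i (pd j (fun y => w y k)) x ^ 2 := by
    rw [pd_component hw, pd_component (contDiff_pd hw j)]
    exact integrable_weight_component cl hpos
      (contDiff_pd (contDiff_pd hw j) i).continuous (h2 i j) k
  have main := integral_weight_sum_pd_mul_pd_le hlam hone hgrad ha
    (fun x => congrFun hdiv x) k0 k1 k2
  have eG (x : Sp) : ∑ i, ‖pd i w x‖ ^ 2 = ∑ i, ∑ j, pd i (fun y => w y j) x ^ 2 := by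
    refine Finset.sum_congr rfl fun i _ => ?_
    rw [EuclideanSpace.real_norm_sq_eq]
    exact Finset.sum_congr rfl fun j _ => by rw [pd_component hw]
  have hG : Integrable fun x => lam x * ∑ i, ∑ j, pd i (fun y => w y j) x ^ 2 := by
    simp only [Finset.mul_sum]
    exact integrable_finsetSum _ fun i _ => integrable_finsetSum _ fun j _ => k1 i j
  have hQ : Integrable fun x =>
      lam x * ∑ i, ∑ j, pd i (fun y => w y j) x * pd j (fun y => w y i) x := by
    simp only [Finset.mul_sum]
    exact integrable_finsetSum _ fun i _ => integrable_finsetSum _ fun j _ =>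
      integrable_weight_mul cl hpos (cp i j) (cp j i) (k1 i j) (k1 j i)
  have hcurl : ∫ x, lam x * ‖curl3 w x‖ ^ 2
      = (∫ x, lam x * ∑ i, ∑ j, pd i (fun y => w y j) x ^ 2)
        - ∫ x, lam x * ∑ i, ∑ j, pd i (fun y => w y j) x * pd j (fun y => w y i) x := by
    rw [← integral_sub hG hQ]
    simp only [norm_curl3_sq, mul_sub]
  simp only [eG, hcurl]
  simp only [EuclideanSpace.real_norm_sq_eq]
  linarith

/-- The right-hand side of the div-curl estimate, with curls of derivatives of order at
most `n`. -/
def weightedCurlEnergy (lam : Sp → ℝ) (z : Sp → Sp) (n : ℕ) : ℝ :=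
  (∫ x : Sp, lam x * ‖z x‖ ^ 2)
    + ∑ k ∈ Finset.range (n + 1), ∑ β ∈ Finset.Nat.antidiagonalTuple 3 k,
        ∫ x : Sp, lam x * ‖curl3 (mpd β z) x‖ ^ 2

section weightedCurlEnergy

variable {lam : Sp → ℝ} {z : Sp → Sp}

lemma integral_weight_norm_sq_nonneg (hpos : ∀ x, 0 ≤ lam x) (v : Sp → Sp) :
    0 ≤ ∫ x, lam x * ‖v x‖ ^ 2 :=
  integral_nonneg fun x => mul_nonneg (hpos x) (sq_nonneg _)

lemma weightedCurlEnergy_mono (hpos : ∀ x, 0 ≤ lam x) {m n : ℕ} (hmn : m ≤ n) :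
    weightedCurlEnergy lam z m ≤ weightedCurlEnergy lam z n := by
  unfold weightedCurlEnergy
  gcongr
  exact fun _ _ _ => Finset.sum_nonneg fun _ _ => integral_weight_norm_sq_nonneg hpos _

lemma integral_weight_curl_le_weightedCurlEnergy (hpos : ∀ x, 0 ≤ lam x) (γ : Fin 3 → ℕ) :
    ∫ x, lam x * ‖curl3 (mpd γ z) x‖ ^ 2 ≤ weightedCurlEnergy lam z (∑ i, γ i) := by
  have hnn (β : Fin 3 → ℕ) := integral_weight_norm_sq_nonneg hpos (curl3 (mpd β z))
  refine le_trans ?_ (le_add_of_nonneg_left (integral_weight_norm_sq_nonneg hpos z))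
  refine le_trans ?_ (Finset.single_le_sum
    (f := fun k => ∑ β ∈ Finset.Nat.antidiagonalTuple 3 k,
      ∫ x : Sp, lam x * ‖curl3 (mpd β z) x‖ ^ 2)
    (fun k _ => Finset.sum_nonneg fun β _ => hnn β)
    (Finset.mem_range.2 (Nat.lt_succ_self (∑ i, γ i))))
  exact Finset.single_le_sum (f := fun β => ∫ x : Sp, lam x * ‖curl3 (mpd β z) x‖ ^ 2)
    (fun β _ => hnn β) (Finset.Nat.mem_antidiagonalTuple.2 rfl)

lemma integral_weight_le_weightedCurlEnergy (hpos : ∀ x, 0 ≤ lam x) (n : ℕ) :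
    ∫ x, lam x * ‖z x‖ ^ 2 ≤ weightedCurlEnergy lam z n :=
  le_add_of_nonneg_right (Finset.sum_nonneg fun _ _ => Finset.sum_nonneg fun _ _ =>
    integral_weight_norm_sq_nonneg hpos _)

end weightedCurlEnergy

lemma exists_integral_weight_sum_pd_mpd_le (C₀ : ℝ) (n : ℕ) :
    ∃ C : ℝ, 0 < C ∧ ∀ γ : Fin 3 → ℕ, ∑ i, γ i = n →
      ∀ lam : Sp → ℝ, ContDiff ℝ (⊤ : ℕ∞) lam → (∀ x, 1 ≤ lam x) →
        (∀ x, ‖fderiv ℝ lam x‖ ≤ C₀ * lam x) →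
      ∀ z : Sp → Sp, ContDiff ℝ (⊤ : ℕ∞) z → div3 z = 0 →
        (∀ β : Fin 3 → ℕ, Integrable (fun x : Sp => lam x * ‖mpd β z x‖ ^ 2)) →
        ∫ x, lam x * ∑ i, ‖pd i (mpd γ z) x‖ ^ 2 ≤ C * weightedCurlEnergy lam z n := by
  have first (γ : Fin 3 → ℕ) (lam : Sp → ℝ) (hlam : ContDiff ℝ (⊤ : ℕ∞) lam)
      (hone : ∀ x, 1 ≤ lam x) (hgrad : ∀ x, ‖fderiv ℝ lam x‖ ≤ C₀ * lam x)
      (z : Sp → Sp) (hz : ContDiff ℝ (⊤ : ℕ∞) z) (hdiv : div3 z = 0)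
      (hint : ∀ β : Fin 3 → ℕ, Integrable (fun x : Sp => lam x * ‖mpd β z x‖ ^ 2)) :
      ∫ x, lam x * ∑ i, ‖pd i (mpd γ z) x‖ ^ 2
        ≤ 2 * weightedCurlEnergy lam z (∑ i, γ i)
          + 3 * C₀ ^ 2 * ∫ x, lam x * ‖mpd γ z x‖ ^ 2 := by
    have hpos (x : Sp) : 0 ≤ lam x := zero_le_one.trans (hone x)
    have h := weighted_div_curl hlam hone hgrad (contDiff_mpd hz γ)
      (div3_mpd_eq_zero hz hdiv γ) (hint γ)
      (fun i => by rw [pd_mpd hz]; exact hint _)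
      (fun i j => by rw [pd_mpd hz, pd_mpd hz]; exact hint _)
    have := integral_weight_curl_le_weightedCurlEnergy (z := z) hpos γ
    linarith
  induction n with
  | zero =>
    refine ⟨2 + 3 * C₀ ^ 2, by positivity, fun γ hγ lam hlam hone hgrad z hz hdiv hint => ?_⟩
    have hpos (x : Sp) : 0 ≤ lam x := zero_le_one.trans (hone x)
    have h := first γ lam hlam hone hgrad z hz hdiv hint
    rw [hγ] at h
    have hγ0 : γ = 0 := by
      funext i
      exact (Finset.sum_eq_zero_iff.1 hγ) i (Finset.mem_univ i)
    have hm : mpd γ z = z := by subst hγ0; rfl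
    rw [hm] at h ⊢
    have := mul_le_mul_of_nonneg_left
      (integral_weight_le_weightedCurlEnergy (z := z) hpos 0) (by positivity : 0 ≤ 3 * C₀ ^ 2)
    linarith
  | succ n ih =>
    obtain ⟨C, hC, ih⟩ := ih
    refine ⟨2 + 3 * C₀ ^ 2 * C, by positivity, fun γ hγ lam hlam hone hgrad z hz hdiv hint => ?_⟩
    have hpos (x : Sp) : 0 ≤ lam x := zero_le_one.trans (hone x)
    have h := first γ lam hlam hone hgrad z hz hdiv hint
    rw [hγ] at h
    obtain ⟨i, hi⟩ : ∃ i, γ i ≠ 0 := by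
      by_contra! hall
      simp [hall] at hγ
    set γ' : Fin 3 → ℕ := Function.update γ i (γ i - 1) with hγ'
    have hup : Function.update γ' i (γ' i + 1) = γ := by
      simp [hγ', Nat.sub_add_cancel (Nat.pos_of_ne_zero hi)]
    have hsum : ∑ j, γ' j = n := by
      have h1 := Finset.sum_update_of_mem (Finset.mem_univ i) γ (γ i - 1)
      have h2 := Finset.add_sum_erase Finset.univ γ (Finset.mem_univ i)
      rw [Finset.sdiff_singleton_eq_erase, ← hγ'] at h1
      omega
    have hstep := ih γ' hsum lam hlam hone hgrad z hz hdiv hint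
    have hIpd (j : Fin 3) : Integrable fun x => lam x * ‖pd j (mpd γ' z) x‖ ^ 2 := by
      rw [pd_mpd hz]; exact hint _
    have hle : ∫ x, lam x * ‖mpd γ z x‖ ^ 2 ≤ ∫ x, lam x * ∑ j, ‖pd j (mpd γ' z) x‖ ^ 2 := by
      refine integral_mono (hint γ) ?_ fun x => ?_
      · simp only [Finset.mul_sum]
        exact integrable_finsetSum _ fun j _ => hIpd j
      · refine mul_le_mul_of_nonneg_left ?_ (hpos x)
        have hm : mpd γ z = pd i (mpd γ' z) := by rw [pd_mpd hz, hup]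
        rw [hm]
        exact Finset.single_le_sum (f := fun j => ‖pd j (mpd γ' z) x‖ ^ 2)
          (fun j _ => sq_nonneg _) (Finset.mem_univ i)
    have hmono := weightedCurlEnergy_mono (z := z) hpos (Nat.le_succ n)
    have hfin : ∫ x, lam x * ‖mpd γ z x‖ ^ 2 ≤ C * weightedCurlEnergy lam z (n + 1) :=
      hle.trans (hstep.trans (mul_le_mul_of_nonneg_left hmono hC.le))
    have := mul_le_mul_of_nonneg_left hfin (by positivity : 0 ≤ 3 * C₀ ^ 2)
    linarith

/-- **Higher-order div-curl estimate.**  Let `λ ≥ 1` be smooth with `|∇λ| ≤ C₀ λ` on `ℝ³`, and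
let `z` be a smooth divergence-free vector field all of whose weighted derivatives
`√λ ∂^β z` lie in `L²(ℝ³)`.  Then for every multi-index `γ`,
`‖√λ ∇(∂^γ z)‖² ≤ C (‖√λ z‖² + Σ_{|β| ≤ |γ|} ‖√λ curl ∂^β z‖²)`, where `C` depends only on
`C₀` and `|γ|`. -/
theorem higher_order_div_curl (C₀ : ℝ) (hC₀ : 0 < C₀) (γ : Fin 3 → ℕ) :
    ∃ C : ℝ, 0 < C ∧
      ∀ lam : Sp → ℝ, ContDiff ℝ (⊤ : ℕ∞) lam → (∀ x, 1 ≤ lam x) →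
        (∀ x, ‖fderiv ℝ lam x‖ ≤ C₀ * lam x) →
      ∀ z : Sp → Sp, ContDiff ℝ (⊤ : ℕ∞) z → (∀ x, div3 z x = 0) →
        (∀ β : Fin 3 → ℕ, Integrable (fun x : Sp => lam x * ‖mpd β z x‖ ^ 2)) →
        (∫ x : Sp, lam x * ‖fderiv ℝ (mpd γ z) x‖ ^ 2)
          ≤ C * ((∫ x : Sp, lam x * ‖z x‖ ^ 2)
              + ∑ k ∈ Finset.range ((∑ i, γ i) + 1),
                  ∑ β ∈ Finset.Nat.antidiagonalTuple 3 k,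
                    ∫ x : Sp, lam x * ‖curl3 (mpd β z) x‖ ^ 2) := by
  obtain ⟨C, hC, h⟩ := exists_integral_weight_sum_pd_mpd_le C₀ (∑ i, γ i)
  refine ⟨C, hC, fun lam hlam hone hgrad z hz hdiv hint => ?_⟩
  have hpos (x : Sp) : 0 ≤ lam x := zero_le_one.trans (hone x)
  refine le_trans ?_ (h γ rfl lam hlam hone hgrad z hz (funext hdiv) hint)
  refine integral_mono_of_nonneg
    (Filter.Eventually.of_forall fun x => mul_nonneg (hpos x) (sq_nonneg _)) ?_
    (Filter.Eventually.of_forall fun x =>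
      mul_le_mul_of_nonneg_left (norm_fderiv_sq_le_sum_pd _ x) (hpos x))
  simp only [Finset.mul_sum]
  refine integrable_finsetSum _ fun i _ => ?_
  rw [pd_mpd hz]
  exact hint _

end
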